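/- Suppose φ₀ ∈ C^∞(ℝ²) satisfies |φ₀(y)| ≤ A(1+|y|)^{−k} for all y ∈ ℝ², where A > 0 and k > 1. Then there is a constant C such that for all t > 0 and all x ∈ ℝ² with |x| ≤ t, |(1/(2πt)) ∫_{|x−y| ≤ t} φ₀(y)(t² − |y−x|²)^{−1/2} dy| ≤ CA / (√(1+t+|x|) · √(1+t−|x|)). -/

import Mathlib

open MeasureTheory Real NNReal ENNReal

noncomputable section

/-- Partial derivative in the `i`-th coordinate direction. -/
def pd {n : ℕ} (i : Fin n) (f : (Fin n → ℝ) → ℝ) : (Fin n → ℝ) → ℝ :=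
  fun y => fderiv ℝ f y (Pi.single i 1)

/-- Euclidean norm on `ℝⁿ`. -/
def rnorm {n : ℕ} (x : Fin n → ℝ) : ℝ := Real.sqrt (∑ i, x i ^ 2)

/-- Laplacian. -/
def lap {n : ℕ} (g : (Fin n → ℝ) → ℝ) : (Fin n → ℝ) → ℝ := fun x => ∑ i, pd i (pd i g) x

/-- time derivative of a time-dependent function -/
def dt {α : Type*} (u : ℝ → α → ℝ) : ℝ → α → ℝ := fun t x => deriv (fun s => u s x) t

/-- Wave operator on spacetime `ℝ^{1+n}` (coordinate `0` is time). -/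
def waveOp {n : ℕ} (f : (Fin (n+1) → ℝ) → ℝ) : (Fin (n+1) → ℝ) → ℝ :=
  fun y => pd 0 (pd 0 f) y - ∑ i : Fin n, pd i.succ (pd i.succ f) y

/-- Index type for the Klainerman vector fields: coordinate derivatives `∂_i`,
the scaling field `L₀`, rotations `Ω_{ij}` (`1 ≤ i < j ≤ n`), and boosts `Ω_{0i}`. -/
abbrev VFIdx (n : ℕ) := (Fin (n+1)) ⊕ (Unit ⊕ (({p : Fin n × Fin n // p.1 < p.2}) ⊕ Fin n))

/-- The Klainerman vector fields, acting on functions on spacetime `ℝ^{1+n}`. -/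
def vf {n : ℕ} : VFIdx n → ((Fin (n+1) → ℝ) → ℝ) → (Fin (n+1) → ℝ) → ℝ
  | Sum.inl i => fun f y => pd i f y
  | Sum.inr (Sum.inl _) => fun f y => ∑ i, y i * pd i f y
  | Sum.inr (Sum.inr (Sum.inl p)) => fun f y =>
      y p.1.1.succ * pd p.1.2.succ f y - y p.1.2.succ * pd p.1.1.succ f y
  | Sum.inr (Sum.inr (Sum.inr i)) => fun f y => y 0 * pd i.succ f y + y i.succ * pd 0 f y

/-- `Z^I`: composition of the Klainerman vector fields indexed by the word `I`. -/
def Zpow {n l : ℕ} (I : Fin l → VFIdx n) (f : (Fin (n+1) → ℝ) → ℝ) :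
    (Fin (n+1) → ℝ) → ℝ :=
  (List.ofFn I).foldr vf f

/-- `L^p` norm of the time-`t` slice of a spacetime function. -/
def sliceNorm {n : ℕ} (f : (Fin (n+1) → ℝ) → ℝ) (t : ℝ) (p : ℝ≥0∞) : ℝ≥0∞ :=
  eLpNorm (fun x : Fin n → ℝ => f (Fin.cons t x)) p volume


theorem aux_one (D b : ℝ) :
    ∫⁻ r : ℝ, ENNReal.ofReal (1 / Real.sqrt (D - (r - b) ^ 2)) ≤ ENNReal.ofReal Real.pi := by
  rw [lintegral_sub_right_eq_self (fun r : ℝ => ENNReal.ofReal (1 / Real.sqrt (D - r ^ 2))) b]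
  rcases le_or_gt D 0 with hD | hD
  · have : ∀ r : ℝ, ENNReal.ofReal (1 / Real.sqrt (D - r ^ 2)) = 0 := fun r => by
      rw [Real.sqrt_eq_zero_of_nonpos (by nlinarith [sq_nonneg r])]; simp
    simp only [this, lintegral_zero, zero_le]
  set R := Real.sqrt D with hR
  have hRp : 0 < R := Real.sqrt_pos.2 hD
  have hRD : D = R ^ 2 := (Real.sq_sqrt hD.le).symm
  set s : Set ℝ := Set.Ioo (-(Real.pi / 2)) (Real.pi / 2) with hs
  set f : ℝ → ℝ := fun θ => R * Real.sin θ with hf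
  set g : ℝ → ℝ≥0∞ := fun r => ENNReal.ofReal (1 / Real.sqrt (D - r ^ 2)) with hg
  have hsupp : ∀ r, r ∉ f '' s → g r = 0 := by
    intro r hr
    have : D - r ^ 2 ≤ 0 := by
      by_contra! h
      have h1 : r ^ 2 < R ^ 2 := by linarith
      have h2 : |r| < R := abs_lt_of_sq_lt_sq h1 hRp.le
      rw [abs_lt] at h2
      have ha : -1 < r / R := by rw [lt_div_iff₀ hRp]; linarith
      have hb : r / R < 1 := by rw [div_lt_iff₀ hRp]; linarith
      apply hr
      refine ⟨Real.arcsin (r / R), ⟨Real.neg_pi_div_two_lt_arcsin.2 ha,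
        Real.arcsin_lt_pi_div_two.2 hb⟩, ?_⟩
      simp only [hf]
      rw [Real.sin_arcsin ha.le hb.le]
      field_simp
    simp only [hg]
    rw [Real.sqrt_eq_zero_of_nonpos this]; simp
  have h1 : ∫⁻ r, g r = ∫⁻ r in f '' s, g r := by
    symm
    apply setLIntegral_eq_of_support_subset
    intro r hr
    by_contra h
    exact hr (hsupp r h)
  rw [h1, lintegral_image_eq_lintegral_abs_deriv_mul (f' := fun θ => R * Real.cos θ)
    measurableSet_Ioo
    (fun x _ => ((Real.hasDerivAt_sin x).const_mul R).hasDerivWithinAt)]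
  · calc ∫⁻ θ in s, ENNReal.ofReal |R * Real.cos θ| * g (f θ) ≤ ∫⁻ θ in s, 1 := by
          apply setLIntegral_mono measurable_const
          intro θ hθ
          have hc : 0 < Real.cos θ := Real.cos_pos_of_mem_Ioo hθ
          have hq : D - (f θ) ^ 2 = (R * Real.cos θ) ^ 2 := by
            simp only [hf]
            rw [hRD]
            nlinarith [Real.sin_sq_add_cos_sq θ]
          have hp : 0 < R * Real.cos θ := by positivity
          simp only [hg]
          rw [hq, Real.sqrt_sq hp.le, abs_of_pos hp, ← ENNReal.ofReal_mul hp.le,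
            mul_one_div_cancel hp.ne']
          simp
      _ = ENNReal.ofReal Real.pi := by
          simp [hs]
  · intro a ha c hc hac
    have : Real.sin a = Real.sin c := mul_left_cancel₀ hRp.ne' hac
    exact Real.injOn_sin (Set.Ioo_subset_Icc_self ha) (Set.Ioo_subset_Icc_self hc) this

theorem aux_two (t a b : ℝ) :
    ∫⁻ p : ℝ × ℝ, (ENNReal.ofReal (Real.sqrt (p.1 ^ 2 + p.2 ^ 2)))⁻¹ *
      ENNReal.ofReal (1 / Real.sqrt (t ^ 2 - ((p.1 - a) ^ 2 + (p.2 - b) ^ 2)))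
      ≤ ENNReal.ofReal (2 * Real.pi ^ 2) := by
  rw [← lintegral_comp_polarCoord_symm]
  set h : ℝ × ℝ → ℝ≥0∞ := fun p => ENNReal.ofReal (1 / Real.sqrt
    ((t ^ 2 - (a ^ 2 + b ^ 2) + (a * Real.cos p.2 + b * Real.sin p.2) ^ 2)
      - (p.1 - (a * Real.cos p.2 + b * Real.sin p.2)) ^ 2)) with hh
  have hm : Measurable h := by
    simp only [hh]; fun_prop
  calc _ ≤ ∫⁻ p in polarCoord.target, h p := by
        apply setLIntegral_mono hm
        rintro ⟨r, θ⟩ hp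
        have hr : 0 < r := hp.1
        simp only [polarCoord_symm_apply, smul_eq_mul, hh]
        have e1 : (r * Real.cos θ) ^ 2 + (r * Real.sin θ) ^ 2 = r ^ 2 := by
          nlinarith [Real.sin_sq_add_cos_sq θ]
        have e2 : t ^ 2 - ((r * Real.cos θ - a) ^ 2 + (r * Real.sin θ - b) ^ 2) =
          ((t ^ 2 - (a ^ 2 + b ^ 2) + (a * Real.cos θ + b * Real.sin θ) ^ 2)
            - (r - (a * Real.cos θ + b * Real.sin θ)) ^ 2) := by
          linear_combination -e1
        rw [e1, e2, Real.sqrt_sq hr.le, ← mul_assoc, ENNReal.mul_inv_cancel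
          (by simpa using hr) ENNReal.ofReal_ne_top, one_mul]
    _ = ∫⁻ θ in Set.Ioo (-Real.pi) Real.pi, ∫⁻ r in Set.Ioi (0:ℝ), h (r, θ) := by
        rw [polarCoord_target, Measure.volume_eq_prod, ← Measure.prod_restrict,
          lintegral_prod_symm' _ hm]
    _ ≤ ∫⁻ θ in Set.Ioo (-Real.pi) Real.pi, ENNReal.ofReal Real.pi := by
        apply lintegral_mono
        intro θ
        exact (setLIntegral_le_lintegral _ _).trans (aux_one
          (t ^ 2 - (a ^ 2 + b ^ 2) + (a * Real.cos θ + b * Real.sin θ) ^ 2)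
          (a * Real.cos θ + b * Real.sin θ))
    _ = ENNReal.ofReal (2 * Real.pi ^ 2) := by
        rw [setLIntegral_const, Real.volume_Ioo, ← ENNReal.ofReal_mul Real.pi_pos.le]
        congr 1; ring

theorem rnorm_two (y : Fin 2 → ℝ) : rnorm y = Real.sqrt (y 0 ^ 2 + y 1 ^ 2) := by
  simp [rnorm, Fin.sum_univ_two]

theorem rnorm_nonneg' (y : Fin 2 → ℝ) : 0 ≤ rnorm y := Real.sqrt_nonneg _

theorem rnorm_eq_norm (y : Fin 2 → ℝ) : rnorm y = ‖WithLp.toLp 2 y‖ := by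
  simp [rnorm, EuclideanSpace.norm_eq]

theorem rnorm_le_add (x y : Fin 2 → ℝ) : rnorm y ≤ rnorm x + rnorm (x - y) := by
  simp only [rnorm_eq_norm, WithLp.toLp_sub]
  exact norm_le_norm_add_norm_sub _ _

theorem aux_three (t : ℝ) (x : Fin 2 → ℝ) :
    ∫⁻ y : Fin 2 → ℝ, (ENNReal.ofReal (rnorm y))⁻¹ *
      ENNReal.ofReal (1 / Real.sqrt (t ^ 2 - rnorm (y - x) ^ 2))
      ≤ ENNReal.ofReal (2 * Real.pi ^ 2) := by
  refine le_trans (le_of_eq ?_) (aux_two t (x 0) (x 1))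
  rw [← (volume_preserving_finTwoArrow ℝ).lintegral_comp_emb
    (MeasurableEquiv.finTwoArrow (α := ℝ)).measurableEmbedding]
  apply lintegral_congr
  intro y
  rw [rnorm_two, rnorm_two, Real.sq_sqrt (by positivity)]
  simp [MeasurableEquiv.finTwoArrow]

/-- Estimate of the first term of the Poisson formula for the 2D wave equation,
interior region `|x| ≤ t`, with slowly decaying data `|φ₀| ≤ A(1+|·|)^{−k}`, `k > 1`. -/
theorem stmt_18 (A k : ℝ) (hA : 0 < A) (hk : 1 < k)
    (φ₀ : (Fin 2 → ℝ) → ℝ) (hs : ContDiff ℝ (⊤:ℕ∞) φ₀)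
    (hd : ∀ y, |φ₀ y| ≤ A / (1 + rnorm y) ^ k) :
    ∃ C : ℝ, 0 < C ∧ ∀ t : ℝ, 0 < t → ∀ x : Fin 2 → ℝ, rnorm x ≤ t →
      |(1 / (2 * Real.pi * t)) *
          ∫ y in {y : Fin 2 → ℝ | rnorm (x - y) ≤ t},
            φ₀ y / Real.sqrt (t^2 - rnorm (y - x) ^ 2)| ≤
        C * A / (Real.sqrt (1 + t + rnorm x) * Real.sqrt (1 + t - rnorm x)) := by
  have hpi := Real.pi_pos
  refine ⟨2 * Real.pi, by positivity, ?_⟩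
  intro t ht x hx
  have hx0 := rnorm_nonneg' x
  set c : ℝ := A * (2 * t / (1 + t)) with hc
  have hc0 : 0 ≤ c := by positivity
  have hmeas : MeasurableSet {y : Fin 2 → ℝ | rnorm (x - y) ≤ t} := by
    apply measurableSet_le _ measurable_const
    unfold rnorm
    fun_prop
  have key : ENNReal.ofReal |∫ y in {y : Fin 2 → ℝ | rnorm (x - y) ≤ t},
      φ₀ y / Real.sqrt (t^2 - rnorm (y - x) ^ 2)| ≤ ENNReal.ofReal (c * (2 * Real.pi ^ 2)) := by
    rw [← Real.enorm_eq_ofReal_abs]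
    refine (enorm_integral_le_lintegral_enorm _).trans ?_
    calc _ ≤ ∫⁻ y in {y : Fin 2 → ℝ | rnorm (x - y) ≤ t}, ENNReal.ofReal c *
          ((ENNReal.ofReal (rnorm y))⁻¹ *
            ENNReal.ofReal (1 / Real.sqrt (t ^ 2 - rnorm (y - x) ^ 2))) := by
          apply setLIntegral_mono' hmeas
          intro y hy
          have hy' : rnorm (x - y) ≤ t := hy
          have hy0 := rnorm_nonneg' y
          have hy2 : rnorm y ≤ 2 * t := by linarith [rnorm_le_add x y]
          have hb : |φ₀ y| ≤ A / (1 + rnorm y) := by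
            refine (hd y).trans ?_
            apply div_le_div_of_nonneg_left hA.le (by positivity)
            exact Real.self_le_rpow_of_one_le (by linarith) hk.le
          rw [Real.enorm_eq_ofReal_abs, abs_div, abs_of_nonneg (Real.sqrt_nonneg _),
            div_eq_mul_one_div, ENNReal.ofReal_mul (abs_nonneg _), ← mul_assoc]
          gcongr
          rcases hy0.eq_or_lt with h0 | h0
          · rw [← h0]
            have : 0 < c := by positivity
            simp only [ENNReal.ofReal_zero, ENNReal.inv_zero]
            rw [ENNReal.mul_top (by simpa using this)]
            exact le_top
          · rw [← ENNReal.ofReal_inv_of_pos h0, ← ENNReal.ofReal_mul hc0]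
            apply ENNReal.ofReal_le_ofReal
            refine hb.trans ?_
            have : c * (rnorm y)⁻¹ = A * (2 * t) / ((1 + t) * rnorm y) := by
              rw [hc]; field_simp
            rw [this, div_le_div_iff₀ (by positivity) (by positivity), mul_assoc]
            apply mul_le_mul_of_nonneg_left _ hA.le
            nlinarith [mul_pos ht h0]
      _ ≤ ∫⁻ y : Fin 2 → ℝ, ENNReal.ofReal c * ((ENNReal.ofReal (rnorm y))⁻¹ *
            ENNReal.ofReal (1 / Real.sqrt (t ^ 2 - rnorm (y - x) ^ 2))) :=
          setLIntegral_le_lintegral _ _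
      _ = ENNReal.ofReal c * ∫⁻ y : Fin 2 → ℝ, ((ENNReal.ofReal (rnorm y))⁻¹ *
            ENNReal.ofReal (1 / Real.sqrt (t ^ 2 - rnorm (y - x) ^ 2))) :=
          lintegral_const_mul' _ _ ENNReal.ofReal_ne_top
      _ ≤ ENNReal.ofReal c * ENNReal.ofReal (2 * Real.pi ^ 2) := by
          gcongr
          exact aux_three t x
      _ = _ := (ENNReal.ofReal_mul hc0).symm
  rw [ENNReal.ofReal_le_ofReal_iff (by positivity)] at key
  rw [abs_mul, abs_of_pos (by positivity : 0 < 1 / (2 * Real.pi * t))]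
  have hprod : Real.sqrt (1 + t + rnorm x) * Real.sqrt (1 + t - rnorm x) ≤ 1 + t := by
    rw [← Real.sqrt_mul (by positivity)]
    apply Real.sqrt_le_iff.2
    constructor
    · positivity
    · nlinarith [sq_nonneg (rnorm x)]
  have hpos : 0 < Real.sqrt (1 + t + rnorm x) * Real.sqrt (1 + t - rnorm x) :=
    mul_pos (Real.sqrt_pos.2 (by linarith)) (Real.sqrt_pos.2 (by linarith))
  calc _ ≤ 1 / (2 * Real.pi * t) * (c * (2 * Real.pi ^ 2)) :=
        mul_le_mul_of_nonneg_left key (by positivity)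
    _ = 2 * Real.pi * A / (1 + t) := by rw [hc]; field_simp
    _ ≤ _ := div_le_div_of_nonneg_left (by positivity) hpos hprod
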